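/- arXiv:2008.11330 — 2 statements merged into one kernel-verified Lean document; each statement's English description precedes it below -/
import Mathlib

section
/- (Proposition on viable thresholds, deterministic angle form.) Let u, û ∈ ℝⁿ be unit vectors with u entrywise nonnegative, and let τ > 0. If sin²θ(u, û) < min( τ²/2 , ⟨u, 1/√n⟩² ), where 1/√n is the normalized all-ones vector, then τ is a viable threshold for the sign-corrected vector û' = sgn(⟨û, 1⟩) · û relative to u: for all indices i, j, û'_j − û'_i > τ implies u_j > u_i. -/
open Finset in
/-- Gram inequality: for unit vectors, `(⟨x, y⟩ - ⟨u, x⟩⟨u, y⟩)² ≤ (1 - ⟨u, x⟩²)(1 - ⟨u, y⟩²)`. -/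
theorem sq_inner_sub_le_of_sum_sq_eq_one {ι : Type*} [Fintype ι] (u x y : ι → ℝ)
    (hu : ∑ k, u k ^ 2 = 1) (hx : ∑ k, x k ^ 2 = 1) (hy : ∑ k, y k ^ 2 = 1) :
    (∑ k, x k * y k - (∑ k, u k * x k) * ∑ k, u k * y k) ^ 2 ≤
      (1 - (∑ k, u k * x k) ^ 2) * (1 - (∑ k, u k * y k) ^ 2) := by
  have key : ∀ (v w : ι → ℝ) (a b : ℝ), ∑ k, (v k - a * u k) * (w k - b * u k) =
      ∑ k, v k * w k - b * ∑ k, u k * v k - a * ∑ k, u k * w k + a * b * ∑ k, u k ^ 2 := by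
    intro v w a b
    simp only [mul_sum, ← sum_sub_distrib, ← sum_add_distrib]
    exact sum_congr rfl fun k _ => by ring
  have h := sum_mul_sq_le_sq_mul_sq univ (fun k => x k - (∑ k, u k * x k) * u k)
    (fun k => y k - (∑ k, u k * y k) * u k)
  simp only [sq (_ - _ * u _), key] at h
  simp only [← sq, hu, hx, hy] at h
  refine le_of_eq_of_le ?_ (h.trans_eq ?_) <;> ring

open Finset in
/-- A coordinate difference satisfies `(r j - r i)² ≤ 2 ‖r‖²`. -/
theorem sq_sub_le_two_mul_sum_sq {ι : Type*} [Fintype ι] (r : ι → ℝ) (i j : ι) :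
    (r j - r i) ^ 2 ≤ 2 * ∑ k, r k ^ 2 := by
  classical
  have hnonneg : 0 ≤ ∑ k, r k ^ 2 := sum_nonneg fun k _ => sq_nonneg _
  by_cases hij : i = j
  · subst hij
    simpa using hnonneg
  · have h : ∑ k ∈ {i, j}, r k ^ 2 ≤ ∑ k, r k ^ 2 :=
      sum_le_sum_of_subset_of_nonneg (subset_univ _) fun k _ _ => sq_nonneg _
    rw [sum_pair hij] at h
    nlinarith [sq_nonneg (r i + r j)]

/-- If `v` is a unit vector with `⟨u, v⟩ ≥ 0` and `1 - ⟨u, v⟩² < τ² / 2`, then gaps of `v`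
larger than `τ` are correctly ordered in `u`. -/
theorem lt_of_gap_of_inner_nonneg {ι : Type*} [Fintype ι] (u v : ι → ℝ)
    (hu : ∑ k, u k ^ 2 = 1) (hv : ∑ k, v k ^ 2 = 1) (hc : 0 ≤ ∑ k, u k * v k)
    {τ : ℝ} (hτ : 0 < τ) (hsin : 1 - (∑ k, u k * v k) ^ 2 < τ ^ 2 / 2) {i j : ι}
    (hij : τ < v j - v i) : u i < u j := by
  by_contra! hle
  set c := ∑ k, u k * v k with hcdef
  have hr : ∑ k, (v k - c * u k) ^ 2 = 1 - c ^ 2 := by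
    have : ∑ k, (v k - c * u k) ^ 2 =
        ∑ k, v k ^ 2 - 2 * c * ∑ k, u k * v k + c ^ 2 * ∑ k, u k ^ 2 := by
      simp only [Finset.mul_sum, ← Finset.sum_sub_distrib, ← Finset.sum_add_distrib]
      exact Finset.sum_congr rfl fun k _ => by ring
    rw [this, hu, hv, ← hcdef]
    ring
  have h := sq_sub_le_two_mul_sum_sq (fun k => v k - c * u k) i j
  rw [hr] at h
  have hgap : τ < (v j - c * u j) - (v i - c * u i) := by
    nlinarith [mul_le_mul_of_nonneg_left hle hc]
  nlinarith

/-- If unit vectors `u, e, v` satisfy `⟨u, e⟩ ≥ 0`, `⟨e, v⟩ ≥ 0` and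
`1 - ⟨u, v⟩² < ⟨u, e⟩²`, then `⟨u, v⟩ ≥ 0`. -/
theorem inner_nonneg_of_one_sub_sq_lt {ι : Type*} [Fintype ι] (u e v : ι → ℝ)
    (hu : ∑ k, u k ^ 2 = 1) (he : ∑ k, e k ^ 2 = 1) (hv : ∑ k, v k ^ 2 = 1)
    (hue : 0 ≤ ∑ k, u k * e k) (hev : 0 ≤ ∑ k, e k * v k)
    (h : 1 - (∑ k, u k * v k) ^ 2 < (∑ k, u k * e k) ^ 2) : 0 ≤ ∑ k, u k * v k := by
  by_contra! hneg
  have hgram := sq_inner_sub_le_of_sum_sq_eq_one u e v hu he hv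
  have hprod := mul_nonneg hue (neg_nonneg.mpr hneg.le)
  nlinarith [mul_nonneg hev hprod, sq_nonneg (∑ k, e k * v k)]


/-- viable thresholds, deterministic angle form. For unit vectors `u, û`
with `u` entrywise nonnegative and `τ > 0`, if `sin²θ(u, û) < min(τ²/2, ⟨u, 1/√n⟩²)` then `τ`
is a viable threshold for the sign-corrected vector `û' = sgn(⟨û, 1⟩) û` relative to `u`:
`û'_j − û'_i > τ` implies `u_j > u_i`. -/
theorem viable_threshold_angle_form
    {n : ℕ} (u uhat : Fin n → ℝ)
    (hu_unit : ∑ k, u k ^ 2 = 1) (huhat_unit : ∑ k, uhat k ^ 2 = 1)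
    (hu_nonneg : ∀ k, 0 ≤ u k)
    (τ : ℝ) (hτ : 0 < τ)
    (hsin : 1 - (∑ k, u k * uhat k) ^ 2 <
      min (τ ^ 2 / 2) ((∑ k, u k * (1 / Real.sqrt (n : ℝ))) ^ 2)) :
    ∀ i j, (Real.sign (∑ k, uhat k) • uhat) j - (Real.sign (∑ k, uhat k) • uhat) i > τ →
      u i < u j := by
  intro i j hij
  have hn : (0 : ℝ) < n := by
    have : 0 < n := i.pos
    exact_mod_cast this
  obtain ⟨hτ_sin, hone_sin⟩ := lt_min_iff.mp hsin
  set s := Real.sign (∑ k, uhat k) with hs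
  have hss : s * ∑ k, uhat k = |∑ k, uhat k| := by
    rcases lt_trichotomy (∑ k, uhat k) 0 with h | h | h
    · rw [hs, Real.sign_of_neg h, abs_of_neg h, neg_one_mul]
    · simp [h]
    · rw [hs, Real.sign_of_pos h, abs_of_pos h, one_mul]
  have hs_ne : s ≠ 0 := by
    intro h0
    simp only [h0, zero_smul, Pi.zero_apply, sub_zero] at hij
    linarith
  have hs_sq : s ^ 2 = 1 := by
    rcases Real.sign_apply_eq (∑ k, uhat k) with h | h | h
    · rw [hs, h]; norm_num
    · exact absurd h hs_ne
    · rw [hs, h]; norm_num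
  have hv : ∑ k, (s • uhat) k ^ 2 = 1 := by
    simp only [Pi.smul_apply, smul_eq_mul, mul_pow, hs_sq, huhat_unit, one_mul]
  have hc : (∑ k, u k * (s • uhat) k) ^ 2 = (∑ k, u k * uhat k) ^ 2 := by
    simp only [Pi.smul_apply, smul_eq_mul, mul_left_comm _ s, ← Finset.mul_sum, mul_pow, hs_sq,
      one_mul]
  have he : ∑ _k : Fin n, (1 / Real.sqrt (n : ℝ)) ^ 2 = 1 := by
    simp [Real.sq_sqrt hn.le, hn.ne']
  have hev : 0 ≤ ∑ k, 1 / Real.sqrt (n : ℝ) * (s • uhat) k := by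
    simp only [Pi.smul_apply, smul_eq_mul, ← Finset.mul_sum, hss]
    positivity
  have hue : 0 ≤ ∑ k, u k * (1 / Real.sqrt (n : ℝ)) :=
    Finset.sum_nonneg fun k _ => mul_nonneg (hu_nonneg k) (by positivity)
  rw [← hc] at hτ_sin hone_sin
  exact lt_of_gap_of_inner_nonneg u (s • uhat) hu_unit hv
    (inner_nonneg_of_one_sub_sq_lt u (fun _ => 1 / Real.sqrt (n : ℝ)) (s • uhat)
      hu_unit he hv hue hev hone_sin) hτ hτ_sin hij
end

section
/- (Proposition on viable thresholds, matrix perturbation form.) Let C and Ĉ be real symmetric n×n matrices; let λ₁ ≥ λ₂ be the two largest eigenvalues of C with eigengap δ = λ₁ − λ₂ > 0, and let u be a unit eigenvector of C associated with λ₁ having entrywise nonnegative entries. Let τ > 0. If ‖Ĉ − C‖₂ < (δ/2) · min( τ/√2 , ⟨u, 1/√n⟩ ), then for every unit eigenvector v̂ of Ĉ associated with its largest eigenvalue, τ is a viable threshold for the sign-corrected vector û = sgn(⟨v̂, 1⟩) · v̂ relative to u: for all indices i, j, û_j − û_i > τ implies u_j > u_i. -/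
/-- The ℓ₂ operator (spectral) norm of a real square matrix. -/
noncomputable def l2OpNorm {n : ℕ} (M : Matrix (Fin n) (Fin n) ℝ) : ℝ :=
  ‖Matrix.toEuclideanCLM (𝕜 := ℝ) M‖

open Matrix in
/-- If every eigenvalue of a real symmetric matrix is at most `t`, so is its Rayleigh quotient. -/
theorem Matrix.IsSymm.dotProduct_mulVec_le_of_eigenvalue_le {n : ℕ}
    {A : Matrix (Fin n) (Fin n) ℝ} (hA : A.IsSymm) {t : ℝ}
    (ht : ∀ (ν : ℝ) (x : Fin n → ℝ), x ≠ 0 → A *ᵥ x = ν • x → ν ≤ t) (x : Fin n → ℝ) :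
    x ⬝ᵥ A *ᵥ x ≤ t * (x ⬝ᵥ x) := by
  have hH : (t • (1 : Matrix (Fin n) (Fin n) ℝ) - A).IsHermitian := by
    rw [Matrix.IsHermitian, conjTranspose_eq_transpose_of_trivial, transpose_sub, transpose_smul,
      transpose_one, hA.eq]
  have hP : (t • (1 : Matrix (Fin n) (Fin n) ℝ) - A).PosSemidef := by
    rw [hH.posSemidef_iff_eigenvalues_nonneg]
    intro i
    have h1 := hH.mulVec_eigenvectorBasis i
    have h2 : A *ᵥ (hH.eigenvectorBasis i).ofLp
        = (t - hH.eigenvalues i) • (hH.eigenvectorBasis i).ofLp := by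
      rw [sub_mulVec, smul_mulVec, one_mulVec] at h1
      rw [sub_smul, ← h1]
      abel
    have h3 : (hH.eigenvectorBasis i).ofLp ≠ 0 := by
      intro h0
      exact hH.eigenvectorBasis.orthonormal.ne_zero i (by ext k; exact congrFun h0 k)
    have := ht _ _ h3 h2
    simp only [Pi.zero_apply]
    linarith
  have h := hP.dotProduct_mulVec_nonneg x
  rw [sub_mulVec, smul_mulVec, one_mulVec, dotProduct_sub, dotProduct_smul, star_trivial,
    smul_eq_mul] at h
  linarith

open Matrix in
/-- The bilinear form of a matrix is bounded by its spectral norm. -/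
theorem dotProduct_mulVec_le_l2OpNorm {n : ℕ} (M : Matrix (Fin n) (Fin n) ℝ)
    (x y : Fin n → ℝ) :
    x ⬝ᵥ M *ᵥ y ≤ l2OpNorm M * (√(x ⬝ᵥ x) * √(y ⬝ᵥ y)) := by
  have hn (z : Fin n → ℝ) : ‖WithLp.toLp 2 z‖ = √(z ⬝ᵥ z) := by
    simp [EuclideanSpace.norm_eq, dotProduct, sq]
  have h1 := real_inner_le_norm (WithLp.toLp 2 x)
    (Matrix.toEuclideanCLM (𝕜 := ℝ) M (WithLp.toLp 2 y))
  have h2 := (Matrix.toEuclideanCLM (𝕜 := ℝ) M).le_opNorm (WithLp.toLp 2 y)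
  have h3 : inner ℝ (WithLp.toLp 2 x) (Matrix.toEuclideanCLM (𝕜 := ℝ) M (WithLp.toLp 2 y))
      = x ⬝ᵥ M *ᵥ y := by
    simp [EuclideanSpace.inner_eq_star_dotProduct, dotProduct_comm]
  rw [h3] at h1
  rw [hn] at h1
  rw [hn y] at h2
  calc x ⬝ᵥ M *ᵥ y ≤ _ := h1
    _ ≤ √(x ⬝ᵥ x) * (l2OpNorm M * √(y ⬝ᵥ y)) :=
      mul_le_mul_of_nonneg_left h2 (Real.sqrt_nonneg _)
    _ = _ := by ring

open Matrix in
/-- The Davis–Kahan bound for leading eigenvectors: the sine `s` of the angle between `u` and `v`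
satisfies `δ s ≤ 2 ‖Ĉ - C‖`. -/
theorem exists_sin_le_of_eigengap {n : ℕ} {C Chat : Matrix (Fin n) (Fin n) ℝ}
    (hC : C.IsSymm) (hChat : Chat.IsSymm) {lam1 lam2 t : ℝ} (hgap : lam2 < lam1)
    {u v : Fin n → ℝ} (hu : u ⬝ᵥ u = 1) (hv : v ⬝ᵥ v = 1) (hu_eig : C *ᵥ u = lam1 • u)
    (hsec : ∀ (ν : ℝ) (x : Fin n → ℝ), x ≠ 0 → C *ᵥ x = ν • x → x ⬝ᵥ u = 0 → ν ≤ lam2)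
    (hv_eig : Chat *ᵥ v = t • v)
    (hmax : ∀ (ν : ℝ) (x : Fin n → ℝ), x ≠ 0 → Chat *ᵥ x = ν • x → ν ≤ t) :
    ∃ s : ℝ, 0 ≤ s ∧ s ^ 2 = 1 - (u ⬝ᵥ v) ^ 2 ∧ (lam1 - lam2) * s ≤ 2 * l2OpNorm (Chat - C) := by
  have symm_form {A : Matrix (Fin n) (Fin n) ℝ} (hA : A.IsSymm) (x y : Fin n → ℝ) :
      x ⬝ᵥ A *ᵥ y = y ⬝ᵥ A *ᵥ x := by
    rw [dotProduct_mulVec, ← mulVec_transpose, hA.eq, dotProduct_comm]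
  set c := u ⬝ᵥ v with hc
  have hvu : v ⬝ᵥ u = c := dotProduct_comm _ _
  have hdefl (x : Fin n → ℝ) : (C - (lam1 - lam2) • vecMulVec u u) *ᵥ x
      = C *ᵥ x - ((lam1 - lam2) * (u ⬝ᵥ x)) • u := by
    rw [sub_mulVec, smul_mulVec, vecMulVec_mulVec]
    ext k
    simp
    ring
  have hsymm' : (C - (lam1 - lam2) • vecMulVec u u).IsSymm := by
    rw [Matrix.IsSymm, transpose_sub, transpose_smul, transpose_vecMulVec, hC.eq]
  have h1 : v ⬝ᵥ C *ᵥ v - (lam1 - lam2) * c ^ 2 ≤ lam2 := by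
    have := hsymm'.dotProduct_mulVec_le_of_eigenvalue_le (t := lam2) (fun ν x hx h => by
      rw [hdefl] at h
      by_cases hxu : u ⬝ᵥ x = 0
      · refine hsec ν x hx ?_ (by rw [dotProduct_comm, hxu])
        simpa [hxu] using h
      · have h' := congrArg (fun y => u ⬝ᵥ y) h
        simp only [dotProduct_sub, dotProduct_smul, symm_form hC u x, hu_eig, hu, smul_eq_mul,
          dotProduct_comm x u] at h'
        have : (lam2 - ν) * (u ⬝ᵥ x) = 0 := by linarith
        rcases mul_eq_zero.1 this with h0 | h0
        · linarith
        · exact absurd h0 hxu) v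
    rw [hdefl, dotProduct_sub, dotProduct_smul, hvu, hv, smul_eq_mul] at this
    linarith
  have h2 : u ⬝ᵥ Chat *ᵥ u ≤ v ⬝ᵥ Chat *ᵥ v := by
    have := hChat.dotProduct_mulVec_le_of_eigenvalue_le hmax u
    rw [hv_eig, dotProduct_smul, hv, smul_eq_mul]
    rwa [hu] at this
  have h3 : u ⬝ᵥ C *ᵥ u = lam1 := by rw [hu_eig, dotProduct_smul, hu, smul_eq_mul, mul_one]
  have h4 := dotProduct_mulVec_le_l2OpNorm (Chat - C) (v - u) (v + u)
  have h5 : (v - u) ⬝ᵥ (Chat - C) *ᵥ (v + u) =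
      (v ⬝ᵥ Chat *ᵥ v - v ⬝ᵥ C *ᵥ v) - (u ⬝ᵥ Chat *ᵥ u - u ⬝ᵥ C *ᵥ u) := by
    simp only [mulVec_add, sub_mulVec, sub_dotProduct, dotProduct_add, dotProduct_sub]
    linarith [symm_form hC u v, symm_form hChat u v]
  have hp : (v - u) ⬝ᵥ (v - u) = 2 - 2 * c := by
    simp only [sub_dotProduct, dotProduct_sub, hu, hv, hvu, ← hc]; ring
  have hq : (v + u) ⬝ᵥ (v + u) = 2 + 2 * c := by
    simp only [add_dotProduct, dotProduct_add, hu, hv, hvu, ← hc]; ring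
  have hp0 : 0 ≤ 2 - 2 * c := hp ▸ Finset.sum_nonneg fun k _ => mul_self_nonneg _
  have hq0 : 0 ≤ 2 + 2 * c := hq ▸ Finset.sum_nonneg fun k _ => mul_self_nonneg _
  rw [h5, hp, hq] at h4
  have hs : (√(2 - 2 * c) * √(2 + 2 * c) / 2) ^ 2 = 1 - c ^ 2 := by
    rw [div_pow, mul_pow, Real.sq_sqrt hp0, Real.sq_sqrt hq0]; ring
  have hs0 : 0 ≤ √(2 - 2 * c) * √(2 + 2 * c) / 2 := by positivity
  refine ⟨√(2 - 2 * c) * √(2 + 2 * c) / 2, hs0, hs, ?_⟩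
  generalize √(2 - 2 * c) * √(2 + 2 * c) = r at *
  have hE : 0 ≤ l2OpNorm (Chat - C) := norm_nonneg _
  rcases hs0.eq_or_lt with h0 | h0
  · rw [← h0]; linarith
  · refine le_of_mul_le_mul_right ?_ h0
    nlinarith

open Matrix in
/-- If the sine `s` of the angle between the unit vectors `u` and `v` is smaller than `⟨u, e⟩` for
a unit vector `e`, then `⟨u, v⟩` and `⟨v, e⟩` do not have opposite signs. -/
theorem dotProduct_mul_dotProduct_nonneg_of_sin_lt {n : ℕ} {u v e : Fin n → ℝ}
    (hu : u ⬝ᵥ u = 1) (hv : v ⬝ᵥ v = 1) (he : e ⬝ᵥ e = 1) {s : ℝ} (hs0 : 0 ≤ s)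
    (hs : s ^ 2 = 1 - (u ⬝ᵥ v) ^ 2) (hlt : s < u ⬝ᵥ e) : 0 ≤ (u ⬝ᵥ v) * (v ⬝ᵥ e) := by
  set c := u ⬝ᵥ v with hc
  set a := u ⬝ᵥ e with ha
  set b := v ⬝ᵥ e with hb
  have hvu : v ⬝ᵥ u = c := dotProduct_comm _ _
  have heu : e ⬝ᵥ u = a := dotProduct_comm _ _
  have hCS : ((v - c • u) ⬝ᵥ (e - a • u)) ^ 2
      ≤ ((v - c • u) ⬝ᵥ (v - c • u)) * ((e - a • u) ⬝ᵥ (e - a • u)) := by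
    simpa [dotProduct, sq] using
      Finset.sum_mul_sq_le_sq_mul_sq Finset.univ (v - c • u) (e - a • u)
  simp only [sub_dotProduct, dotProduct_sub, smul_dotProduct, dotProduct_smul, smul_eq_mul,
    hu, hv, he, hvu, heu, ← hc, ← ha, ← hb] at hCS
  by_contra! hneg
  have ha2 : s ^ 2 < a ^ 2 := by gcongr
  have hca : c * b * a < 0 := mul_neg_of_neg_of_pos hneg (by linarith)
  nlinarith [sq_nonneg b]

/-- viable thresholds, matrix perturbation form. If
`‖Ĉ − C‖₂ < (δ/2) min(τ/√2, ⟨u, 1/√n⟩)`, where `δ = lam1 − lam2` is the eigengap of the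
symmetric matrix `C` and `u` its entrywise-nonnegative leading unit eigenvector, then for every
unit eigenvector `v̂` of `Ĉ` associated with its largest eigenvalue, `τ` is a viable threshold
for the sign-corrected vector `û = sgn(⟨v̂, 1⟩) v̂` relative to `u`. -/
theorem viable_threshold_matrix_form
    {n : ℕ} (C Chat : Matrix (Fin n) (Fin n) ℝ)
    (hC : C.IsSymm) (hChat : Chat.IsSymm)
    (lam1 lam2 : ℝ) (hgap : lam2 < lam1)
    (u : Fin n → ℝ) (hu_unit : ∑ k, u k ^ 2 = 1) (hu_nonneg : ∀ k, 0 ≤ u k)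
    (hu_eig : C.mulVec u = lam1 • u)
    (hmax : ∀ (ν : ℝ) (x : Fin n → ℝ), x ≠ 0 → C.mulVec x = ν • x → ν ≤ lam1)
    (hsec : ∀ (ν : ℝ) (x : Fin n → ℝ), x ≠ 0 → C.mulVec x = ν • x →
      (∑ k, x k * u k) = 0 → ν ≤ lam2)
    (τ : ℝ) (hτ : 0 < τ)
    (hpert : l2OpNorm (Chat - C) <
      (lam1 - lam2) / 2 *
        min (τ / Real.sqrt 2) (∑ k, u k * (1 / Real.sqrt (n : ℝ)))) :
    ∀ vhat : Fin n → ℝ, (∑ k, vhat k ^ 2 = 1) →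
      (∃ t : ℝ, Chat.mulVec vhat = t • vhat ∧
        ∀ (ν : ℝ) (x : Fin n → ℝ), x ≠ 0 → Chat.mulVec x = ν • x → ν ≤ t) →
      ∀ i j, (Real.sign (∑ k, vhat k) • vhat) j - (Real.sign (∑ k, vhat k) • vhat) i > τ →
        u i < u j := by
  intro v hv ⟨t, hv_eig, ht⟩ i j hij
  have hu' : u ⬝ᵥ u = 1 := by simpa [dotProduct, sq] using hu_unit
  have hv' : v ⬝ᵥ v = 1 := by simpa [dotProduct, sq] using hv
  have hn : (0 : ℝ) < n := by
    exact_mod_cast i.pos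
  obtain ⟨s, hs0, hs, hsE⟩ := exists_sin_le_of_eigengap hC hChat hgap hu' hv' hu_eig
    (fun ν x hx h h' => hsec ν x hx h h') hv_eig ht
  have hδ : 0 < lam1 - lam2 := sub_pos.2 hgap
  have hlt : s < min (τ / √2) (∑ k, u k * (1 / √(n : ℝ))) := by
    refine lt_of_mul_lt_mul_left ?_ hδ.le
    linarith
  obtain ⟨hsτ, hsa⟩ := lt_min_iff.1 hlt
  have hcb := dotProduct_mul_dotProduct_nonneg_of_sin_lt (e := fun _ => 1 / √(n : ℝ)) hu' hv'
    (by simp [dotProduct, ← mul_inv, Real.mul_self_sqrt hn.le, hn.ne']) hs0 hs hsa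
  have hb : v ⬝ᵥ (fun _ => 1 / √(n : ℝ)) = (∑ k, v k) * (1 / √(n : ℝ)) := by
    simp only [dotProduct, Finset.sum_mul]
  rw [hb, ← mul_assoc] at hcb
  have hcS : 0 ≤ (u ⬝ᵥ v) * ∑ k, v k := nonneg_of_mul_nonneg_left hcb (by positivity)
  set c := u ⬝ᵥ v with hc
  have hne : i ≠ j := by
    rintro rfl
    linarith
  have hw : ∑ k, (v k - c * u k) ^ 2 = s ^ 2 := by
    have : (v - c • u) ⬝ᵥ (v - c • u) = s ^ 2 := by
      simp only [sub_dotProduct, dotProduct_sub, smul_dotProduct, dotProduct_smul, smul_eq_mul,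
        hu', hv', dotProduct_comm v u, ← hc, hs]
      ring
    simpa [dotProduct, sq] using this
  have hwij : (v i - c * u i) ^ 2 + (v j - c * u j) ^ 2 ≤ s ^ 2 := by
    rw [← hw, ← Finset.sum_pair (f := fun k => (v k - c * u k) ^ 2) hne]
    exact Finset.sum_le_sum_of_subset_of_nonneg (Finset.subset_univ _)
      fun k _ _ => sq_nonneg _
  have hsτ2 : 2 * s ^ 2 < τ ^ 2 := by
    have : s ^ 2 < (τ / √2) ^ 2 := by gcongr
    rw [div_pow, Real.sq_sqrt (by norm_num)] at this
    linarith
  have hwabs : |(v j - c * u j) - (v i - c * u i)| < τ := by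
    refine abs_lt_of_sq_lt_sq ?_ hτ.le
    nlinarith [sq_nonneg ((v j - c * u j) + (v i - c * u i))]
  obtain ⟨hlo, hhi⟩ := abs_lt.1 hwabs
  simp only [Pi.smul_apply, smul_eq_mul] at hij
  by_contra! hle
  rcases lt_trichotomy (∑ k, v k) 0 with h | h | h
  · rw [Real.sign_of_neg h] at hij
    have : c ≤ 0 := nonpos_of_mul_nonneg_left hcS h
    nlinarith
  · rw [h, Real.sign_zero] at hij
    linarith
  · rw [Real.sign_of_pos h] at hij
    have : 0 ≤ c := nonneg_of_mul_nonneg_left hcS h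
    nlinarith
end
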